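/- Let G be a graph with finitely many vertices such that every vertex connects to a loop (for every vertex v there is a loop μ with v ≥ s(μ)) and such that the only hereditary saturated subsets of G⁰ are ∅ and G⁰ (these conditions hold whenever the graph C*-algebra C*(G) is unital and purely infinite simple). Then there is a graph E with finitely many vertices, no sinks, no sources, satisfying: (i) every vertex of E supports a loop of length one; (ii) any two regular vertices of E are connected by a path all of whose vertices are regular; (iii) every infinite emitter of E emits infinitely many edges to every vertex of E; and (iv) E ∼_M G. -/

import Mathlib

/-- A directed graph as used in the theory of graph `C*`-algebras:
a type of vertices, a type of edges, and range and source maps. -/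
structure CKGraph : Type 1 where
  V : Type
  E : Type
  r : E → V
  s : E → V

namespace CKGraph

/-- An isomorphism of graphs: bijections of vertices and edges intertwining
the range and source maps. -/
structure Iso (G H : CKGraph) where
  vEquiv : G.V ≃ H.V
  eEquiv : G.E ≃ H.E
  map_r : ∀ e, H.r (eEquiv e) = vEquiv (G.r e)
  map_s : ∀ e, H.s (eEquiv e) = vEquiv (G.s e)

/-- A vertex is a source if it receives no edges. -/
def IsSource (G : CKGraph) (v : G.V) : Prop := ∀ e, G.r e ≠ v

/-- A vertex is a sink if it emits no edges. -/
def IsSink (G : CKGraph) (v : G.V) : Prop := ∀ e, G.s e ≠ v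

/-- A vertex is an infinite emitter if it emits infinitely many edges. -/
def IsInfiniteEmitter (G : CKGraph) (v : G.V) : Prop := {e | G.s e = v}.Infinite

/-- A vertex is regular if it is neither a sink nor an infinite emitter. -/
def Regular (G : CKGraph) (v : G.V) : Prop :=
  (∃ e, G.s e = v) ∧ {e | G.s e = v}.Finite

/-- There is a (nonempty) path from `u` to `v` in `G`. -/
inductive HasPath (G : CKGraph) : G.V → G.V → Prop
  | single (e : G.E) : HasPath G (G.s e) (G.r e)
  | cons (e : G.E) {v : G.V} : HasPath G (G.r e) v → HasPath G (G.s e) v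

/-- `G.Geq u v` is the relation `u ≥ v`: `u = v` or there is a path from `u` to `v`. -/
def Geq (G : CKGraph) (u v : G.V) : Prop := u = v ∨ G.HasPath u v

/-- There is a (nonempty) path from `u` to `v` all of whose vertices lie in `S`. -/
inductive HasPathIn (G : CKGraph) (S : Set G.V) : G.V → G.V → Prop
  | single (e : G.E) : G.s e ∈ S → G.r e ∈ S → HasPathIn G S (G.s e) (G.r e)
  | cons (e : G.E) {v : G.V} : G.s e ∈ S → HasPathIn G S (G.r e) v →
      HasPathIn G S (G.s e) v

/-- The nonempty list of edges `l` is a path from `u` to `v`. -/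
def IsPathFromTo (G : CKGraph) (l : List G.E) (u v : G.V) : Prop :=
  ∃ h : l ≠ [], l.Chain' (fun e f => G.r e = G.s f) ∧
    G.s (l.head h) = u ∧ G.r (l.getLast h) = v

/-- The list of edges `l` is a simple loop based at `v`: a loop at `v` such that the
range of every non-final edge is different from `v`. -/
def IsSimpleLoopAt (G : CKGraph) (v : G.V) (l : List G.E) : Prop :=
  G.IsPathFromTo l v v ∧ ∀ e ∈ l.dropLast, G.r e ≠ v

/-- A set of vertices is hereditary if it contains the range of every edge whose
source it contains. -/
def Hereditary (G : CKGraph) (H : Set G.V) : Prop := ∀ e, G.s e ∈ H → G.r e ∈ H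

/-- A set of vertices is saturated if it contains every regular vertex all of whose
emitted edges have range in the set. -/
def Saturated (G : CKGraph) (H : Set G.V) : Prop :=
  ∀ v, G.Regular v → (∀ e, G.s e = v → G.r e ∈ H) → v ∈ H

/-- Move (S): removing the (regular) source `v` together with all edges it emits. -/
def removeSource (G : CKGraph) (v : G.V) (hsrc : G.IsSource v) : CKGraph where
  V := {w : G.V // w ≠ v}
  E := {e : G.E // G.s e ≠ v}
  r e := ⟨G.r e.1, hsrc e.1⟩
  s e := ⟨G.s e.1, e.2⟩

/-- Move (R): the reduction at a vertex `u` that emits exactly one edge `f` with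
`r f ≠ u` and receives only from the single vertex `v`. -/
def reduce (G : CKGraph) (u : G.V) (f : G.E) (hf : G.s f = u) (hrf : G.r f ≠ u)
    (honly : ∀ e, G.s e = u → e = f) (v : G.V) (hin : ∀ e, G.r e = u → G.s e = v) :
    CKGraph where
  V := {w : G.V // w ≠ u}
  E := {e : G.E // G.r e ≠ u ∧ e ≠ f} ⊕ {e : G.E // G.r e = u}
  r x :=
    match x with
    | .inl e => ⟨G.r e.1, e.2.1⟩
    | .inr _ => ⟨G.r f, hrf⟩
  s x :=
    match x with
    | .inl e => ⟨G.s e.1, fun h => e.2.2 (honly e.1 h)⟩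
    | .inr e => ⟨G.s e.1, by
        intro h
        have h2 : G.r e.1 = u := e.2
        rw [honly e.1 h] at h2
        exact hrf h2⟩

/-- Move (O): the out-split of `G` at `v` according to the partition of `s⁻¹(v)`
into the fibres of `P`. -/
noncomputable def outSplit (G : CKGraph) (v : G.V) (n : ℕ)
    (P : {e : G.E // G.s e = v} → Fin n) : CKGraph :=
  letI := Classical.decEq G.V
  { V := {w : G.V // w ≠ v} ⊕ Fin n
    E := {e : G.E // G.r e ≠ v} ⊕ ({e : G.E // G.r e = v} × Fin n)
    r := fun x =>
      match x with
      | .inl e => Sum.inl ⟨G.r e.1, e.2⟩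
      | .inr p => Sum.inr p.2
    s := fun x =>
      match x with
      | .inl e =>
          if h : G.s e.1 = v then Sum.inr (P ⟨e.1, h⟩) else Sum.inl ⟨G.s e.1, h⟩
      | .inr p =>
          if h : G.s p.1.1 = v then Sum.inr (P ⟨p.1.1, h⟩)
          else Sum.inl ⟨G.s p.1.1, h⟩ }

/-- Move (I): the in-split of `G` at `v` according to the partition of `r⁻¹(v)`
into the fibres of `P`. -/
noncomputable def inSplit (G : CKGraph) (v : G.V) (n : ℕ)
    (P : {e : G.E // G.r e = v} → Fin n) : CKGraph :=
  letI := Classical.decEq G.V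
  { V := {w : G.V // w ≠ v} ⊕ Fin n
    E := {e : G.E // G.s e ≠ v} ⊕ ({e : G.E // G.s e = v} × Fin n)
    s := fun x =>
      match x with
      | .inl e => Sum.inl ⟨G.s e.1, e.2⟩
      | .inr p => Sum.inr p.2
    r := fun x =>
      match x with
      | .inl e =>
          if h : G.r e.1 = v then Sum.inr (P ⟨e.1, h⟩) else Sum.inl ⟨G.r e.1, h⟩
      | .inr p =>
          if h : G.r p.1.1 = v then Sum.inr (P ⟨p.1.1, h⟩)
          else Sum.inl ⟨G.r p.1.1, h⟩ }

/-- Move-equivalence: the smallest equivalence relation on graphs with finitely many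
vertices such that `G ∼ H` whenever `H` is obtained from `G`, up to graph
isomorphism, by one of the moves (S), (I), (O), (R). -/
inductive MoveEquiv : CKGraph → CKGraph → Prop
  | of_iso {G H : CKGraph} (hG : Finite G.V) (h : Nonempty (Iso G H)) : MoveEquiv G H
  | moveS {G : CKGraph} (hG : Finite G.V) (v : G.V) (hreg : G.Regular v)
      (hsrc : G.IsSource v) {H : CKGraph}
      (h : Nonempty (Iso H (G.removeSource v hsrc))) : MoveEquiv G H
  | moveR {G : CKGraph} (hG : Finite G.V) (u : G.V) (f : G.E) (hf : G.s f = u)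
      (hrf : G.r f ≠ u) (honly : ∀ e, G.s e = u → e = f) (v : G.V)
      (hin : ∀ e, G.r e = u → G.s e = v) {H : CKGraph}
      (h : Nonempty (Iso H (G.reduce u f hf hrf honly v hin))) : MoveEquiv G H
  | moveO {G : CKGraph} (hG : Finite G.V) (v : G.V) (hns : ¬ G.IsSink v) (n : ℕ)
      (P : {e : G.E // G.s e = v} → Fin n) (hsurj : Function.Surjective P)
      (hinf : ∀ i j : Fin n, {x : {e : G.E // G.s e = v} | P x = i}.Infinite →
        {x : {e : G.E // G.s e = v} | P x = j}.Infinite → i = j)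
      {H : CKGraph} (h : Nonempty (Iso H (G.outSplit v n P))) : MoveEquiv G H
  | moveI {G : CKGraph} (hG : Finite G.V) (v : G.V) (hreg : G.Regular v)
      (hns : ¬ G.IsSource v) (n : ℕ) (P : {e : G.E // G.r e = v} → Fin n)
      (hsurj : Function.Surjective P) {H : CKGraph}
      (h : Nonempty (Iso H (G.inSplit v n P))) : MoveEquiv G H
  | symm {G H : CKGraph} : MoveEquiv G H → MoveEquiv H G
  | trans {G H K : CKGraph} : MoveEquiv G H → MoveEquiv H K → MoveEquiv G K

/-- The graph obtained from `G` by collapsing a regular non-source vertex `v` that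
emits exactly one edge `f₀`, which is not a loop: delete `v`, `f₀` and all edges into
`v`, and add an edge `[e f₀]` from `s e` to `r f₀` for every edge `e` into `v`. -/
def collapseOne (G : CKGraph) (v : G.V) (f₀ : G.E) (hf : G.s f₀ = v)
    (honly : ∀ e, G.s e = v → e = f₀) (hr : G.r f₀ ≠ v) : CKGraph where
  V := {w : G.V // w ≠ v}
  E := {e : G.E // G.r e ≠ v ∧ e ≠ f₀} ⊕ {e : G.E // G.r e = v}
  r x :=
    match x with
    | .inl e => ⟨G.r e.1, e.2.1⟩
    | .inr _ => ⟨G.r f₀, hr⟩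
  s x :=
    match x with
    | .inl e => ⟨G.s e.1, fun h => e.2.2 (honly e.1 h)⟩
    | .inr e => ⟨G.s e.1, by
        intro h
        have h2 : G.r e.1 = v := e.2
        rw [honly e.1 h] at h2
        exact hr h2⟩

/-- The graph obtained from `G` by collapsing a regular vertex `v` which does not
support a loop of length one: delete `v` and all edges into or out of `v`, and add
an edge `[e f]` from `s e` to `r f` for every pair of edges `e, f` with
`r e = v = s f`. -/
def collapse (G : CKGraph) (v : G.V) (hnl : ∀ e, G.s e = v → G.r e ≠ v) :
    CKGraph where
  V := {w : G.V // w ≠ v}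
  E := {e : G.E // G.r e ≠ v ∧ G.s e ≠ v} ⊕
    ({e : G.E // G.r e = v} × {f : G.E // G.s f = v})
  s x :=
    match x with
    | .inl e => ⟨G.s e.1, e.2.2⟩
    | .inr p => ⟨G.s p.1.1, fun h => hnl p.1.1 h p.1.2⟩
  r x :=
    match x with
    | .inl e => ⟨G.r e.1, e.2.1⟩
    | .inr p => ⟨G.r p.2.1, fun h => hnl p.2.1 p.2.2 h⟩

/-- The graph obtained from `G` by adding countably infinitely many new edges,
each with source `u` and range `w`. -/
def addEdges (G : CKGraph) (u w : G.V) : CKGraph where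
  V := G.V
  E := G.E ⊕ ℕ
  r x := match x with | .inl e => G.r e | .inr _ => w
  s x := match x with | .inl e => G.s e | .inr _ => u

/-- The graph with exactly one vertex and no edges. -/
def singletonGraph : CKGraph where
  V := PUnit
  E := Empty
  r e := e.elim
  s e := e.elim

/-- The Cuntz splice of `G` at `v`: add two new vertices `u₁, u₂` and six new edges:
`v → u₁`, `u₁ → v`, a loop at `u₁`, `u₁ → u₂`, `u₂ → u₁`, and a loop at `u₂`. -/
def cuntzSplice (G : CKGraph) (v : G.V) : CKGraph where
  V := G.V ⊕ Fin 2
  E := G.E ⊕ Fin 6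
  s x :=
    match x with
    | .inl e => Sum.inl (G.s e)
    | .inr i => ![Sum.inl v, Sum.inr 0, Sum.inr 0, Sum.inr 0, Sum.inr 1, Sum.inr 1] i
  r x :=
    match x with
    | .inl e => Sum.inl (G.r e)
    | .inr i => ![Sum.inr 0, Sum.inl v, Sum.inr 0, Sum.inr 1, Sum.inr 0, Sum.inr 1] i

/-- The adjacency matrix (as an integer matrix) of a graph whose vertices are
enumerated by `Fin n`. -/
noncomputable def adjMatrix (G : CKGraph) {n : ℕ} (ρ : G.V ≃ Fin n) :
    Matrix (Fin n) (Fin n) ℤ :=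
  Matrix.of fun i j => (Nat.card {e : G.E // G.s e = ρ.symm i ∧ G.r e = ρ.symm j} : ℤ)

end CKGraph

/-- The graph of an `ℕ∞`-valued square matrix: it has exactly `A x y` edges from
`x` to `y`. -/
def graphOfMatrix {n : ℕ} (A : Matrix (Fin n) (Fin n) ℕ∞) : CKGraph where
  V := Fin n
  E := Σ x : Fin n, Σ y : Fin n, {k : ℕ // (k : ℕ∞) < A x y}
  s e := e.1
  r e := e.2.1

/-- Move-equivalence of (possibly differently sized) square matrices over `ℕ∞`. -/
def MatMoveEquiv {m n : ℕ} (A : Matrix (Fin m) (Fin m) ℕ∞)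
    (B : Matrix (Fin n) (Fin n) ℕ∞) : Prop :=
  CKGraph.MoveEquiv (graphOfMatrix A) (graphOfMatrix B)

/-- A square matrix is irreducible if any index connects to any other index through
a chain of non-zero entries. -/
def MatIrreducible {n : ℕ} {α : Type*} [Zero α] (A : Matrix (Fin n) (Fin n) α) :
    Prop :=
  ∀ i j : Fin n, ∃ (l : ℕ) (c : ℕ → Fin n), 1 ≤ l ∧ c 0 = i ∧ c l = j ∧
    ∀ t < l, A (c t) (c (t + 1)) ≠ 0

/-- `Jmat n m` is the `n × n` matrix whose top-left `m × m` block is the identity,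
whose other entries in the first `m` rows are `0`, and whose last `n - m` rows have
every entry equal to `∞`. -/
def Jmat (n m : ℕ) : Matrix (Fin n) (Fin n) ℕ∞ :=
  Matrix.of fun i j => if i.1 < m then (if i = j then 1 else 0) else ⊤

section Split

variable {α : Type*}

open Classical in
/-- Replace a point `x` of a type with an extra point adjoined by two points. -/
noncomputable def splitPoint (x : α) : Option α → {a : α // a ≠ x} ⊕ Fin 2
  | none => .inr 0
  | some a => if h : a = x then .inr 1 else .inl ⟨a, h⟩

theorem splitPoint_bijective (x : α) : (splitPoint x).Bijective := by
  constructor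
  · rintro (_ | a) (_ | b) h
    · rfl
    · by_cases hb : b = x <;> simp [splitPoint, hb] at h
    · by_cases ha : a = x <;> simp [splitPoint, ha] at h
    · by_cases ha : a = x <;> by_cases hb : b = x <;> simp [splitPoint, ha, hb] at h ⊢
      exact h
  · rintro (⟨w, hw⟩ | i)
    · exact ⟨some w, by simp [splitPoint, hw]⟩
    · fin_cases i
      · exact ⟨none, rfl⟩
      · exact ⟨some x, by simp [splitPoint]⟩

open Classical in
/-- Collect the elements satisfying `p` together with their duplicates. -/
noncomputable def splitDup (p : α → Prop) :
    α ⊕ {a : α // p a} → {a : α // ¬ p a} ⊕ ({a : α // p a} × Fin 2)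
  | .inl a => if h : p a then .inr (⟨a, h⟩, 1) else .inl ⟨a, h⟩
  | .inr a => .inr (a, 0)

theorem splitDup_bijective (p : α → Prop) : (splitDup p).Bijective := by
  constructor
  · rintro (a | a) (b | b) h
    · by_cases ha : p a <;> by_cases hb : p b <;> simp [splitDup, ha, hb] at h ⊢ <;> exact h
    · by_cases ha : p a <;> simp [splitDup, ha] at h
    · by_cases hb : p b <;> simp [splitDup, hb] at h
    · simpa [splitDup] using h
  · rintro (⟨a, ha⟩ | ⟨⟨a, ha⟩, i⟩)
    · exact ⟨.inl a, by simp [splitDup, ha]⟩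
    · fin_cases i
      · exact ⟨.inr ⟨a, ha⟩, rfl⟩
      · exact ⟨.inl a, by simp [splitDup, ha]⟩

end Split

namespace CKGraph

section Moves

variable {G : CKGraph}

theorem nonempty_iso_of_bijective {G H : CKGraph} (φ : G.V → H.V) (ψ : G.E → H.E)
    (hφ : φ.Bijective) (hψ : ψ.Bijective) (hr : ∀ e, H.r (ψ e) = φ (G.r e))
    (hs : ∀ e, H.s (ψ e) = φ (G.s e)) : Nonempty (Iso G H) :=
  ⟨⟨Equiv.ofBijective φ hφ, Equiv.ofBijective ψ hψ, hr, hs⟩⟩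

theorem nonempty_iso_refl (G : CKGraph) : Nonempty (Iso G G) :=
  ⟨⟨Equiv.refl _, Equiv.refl _, fun _ => rfl, fun _ => rfl⟩⟩

theorem MoveEquiv.refl (hG : Finite G.V) : MoveEquiv G G :=
  .of_iso hG (nonempty_iso_refl G)

theorem regular_of_unique_edge {x : G.V} {f : G.E} (hf : ∀ e, G.s e = x ↔ e = f) :
    G.Regular x :=
  ⟨⟨f, (hf f).2 rfl⟩, (Set.finite_singleton f).subset fun e he => (hf e).1 he⟩

open Classical in
/-- The graph `G` with every edge in `A` redirected to end at `y`. -/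
noncomputable def redirect (G : CKGraph) (A : Set G.E) (y : G.V) : CKGraph where
  V := G.V
  E := G.E
  r e := if e ∈ A then y else G.r e
  s := G.s

open Classical in
/-- The in-split of `G` at `x` with respect to the partition of `r⁻¹(x)` into `A` and its
complement: `none` is the copy of `x` receiving the edges in `A`. -/
noncomputable def inTwin (G : CKGraph) (x : G.V) (A : Set G.E) : CKGraph where
  V := Option G.V
  E := G.E ⊕ {e : G.E // G.s e = x}
  r
    | .inl e => if e ∈ A then none else some (G.r e)
    | .inr e => if e.1 ∈ A then none else some (G.r e.1)
  s
    | .inl e => some (G.s e)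
    | .inr _ => none

open Classical in
/-- The out-split of `G` at `x` with respect to the partition of `s⁻¹(x)` into `F` and its
complement: `none` is the copy of `x` emitting the edges in `F`. -/
noncomputable def outTwin (G : CKGraph) (x : G.V) (F : Set G.E) : CKGraph where
  V := Option G.V
  E := G.E ⊕ {e : G.E // G.r e = x}
  r
    | .inl e => some (G.r e)
    | .inr _ => none
  s
    | .inl e => if e ∈ F then none else some (G.s e)
    | .inr e => if e.1 ∈ F then none else some (G.s e.1)

theorem finite_inTwin (hG : Finite G.V) (x : G.V) (A : Set G.E) : Finite (G.inTwin x A).V :=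
  inferInstanceAs (Finite (Option G.V))

theorem finite_outTwin (hG : Finite G.V) (x : G.V) (F : Set G.E) :
    Finite (G.outTwin x F).V :=
  inferInstanceAs (Finite (Option G.V))

theorem moveEquiv_inTwin (hG : Finite G.V) {x : G.V} (hx : G.Regular x) {A : Set G.E}
    (hA : ∀ e ∈ A, G.r e = x) (hne : A.Nonempty) (hrest : ∃ e, G.r e = x ∧ e ∉ A) :
    MoveEquiv G (G.inTwin x A) := by
  classical
  obtain ⟨e₀, he₀, he₀A⟩ := hrest
  obtain ⟨e₁, he₁⟩ := hne
  let P : {e : G.E // G.r e = x} → Fin 2 := fun e => if e.1 ∈ A then 0 else 1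
  refine .moveI hG x hx (fun h => h e₀ he₀) 2 P ?_ (nonempty_iso_of_bijective (splitPoint x)
    (splitDup fun e => G.s e = x) (splitPoint_bijective x) (splitDup_bijective _) ?_ ?_)
  · intro i
    fin_cases i
    · exact ⟨⟨e₁, hA e₁ he₁⟩, if_pos he₁⟩
    · exact ⟨⟨e₀, he₀⟩, if_neg he₀A⟩
  · have hA' : ∀ e, G.r e ≠ x → e ∉ A := fun e h h' => h (hA e h')
    rintro (e | ⟨e, he⟩)
    · by_cases h : G.r e = x
      · by_cases h1 : G.s e = x <;> by_cases h2 : e ∈ A <;>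
          simp [splitPoint, splitDup, inSplit, inTwin, P, h, h1, h2]
      · by_cases h1 : G.s e = x <;>
          simp [splitPoint, splitDup, inSplit, inTwin, h, h1, hA' e h]
    · by_cases h : G.r e = x
      · by_cases h2 : e ∈ A <;> simp [splitPoint, splitDup, inSplit, inTwin, P, h, h2]
      · simp [splitPoint, splitDup, inSplit, inTwin, h, hA' e h]
  · rintro (e | e)
    · by_cases h : G.s e = x <;> simp [splitPoint, splitDup, inSplit, inTwin, h]
    · simp [splitPoint, splitDup, inSplit, inTwin]

theorem moveEquiv_outTwin (hG : Finite G.V) {x : G.V} {F : Set G.E}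
    (hF : ∀ e ∈ F, G.s e = x) (hne : F.Nonempty) (hfin : F.Finite)
    (hrest : ∃ e, G.s e = x ∧ e ∉ F) : MoveEquiv G (G.outTwin x F) := by
  classical
  obtain ⟨e₀, he₀, he₀F⟩ := hrest
  obtain ⟨e₁, he₁⟩ := hne
  let P : {e : G.E // G.s e = x} → Fin 2 := fun e => if e.1 ∈ F then 0 else 1
  have hP : ∀ i, {e | P e = i}.Infinite → i = 1 := by
    intro i hi
    fin_cases i
    · refine absurd ((hfin.preimage Subtype.val_injective.injOn).subset ?_) hi
      intro e he
      by_contra h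
      have h' : e.1 ∉ F := h
      simp [P, h'] at he
    · rfl
  refine .moveO hG x (fun h => h e₀ he₀) 2 P ?_
    (fun i j hi hj => (hP i hi).trans (hP j hj).symm) (nonempty_iso_of_bijective (splitPoint x)
    (splitDup fun e => G.r e = x) (splitPoint_bijective x) (splitDup_bijective _) ?_ ?_)
  · intro i
    fin_cases i
    · exact ⟨⟨e₁, hF e₁ he₁⟩, if_pos he₁⟩
    · exact ⟨⟨e₀, he₀⟩, if_neg he₀F⟩
  · rintro (e | e)
    · by_cases h : G.r e = x <;> simp [splitPoint, splitDup, outSplit, outTwin, h]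
    · simp [splitPoint, splitDup, outSplit, outTwin]
  · have hF' : ∀ e, G.s e ≠ x → e ∉ F := fun e h h' => h (hF e h')
    rintro (e | ⟨e, he⟩)
    · by_cases h : G.s e = x
      · by_cases h1 : G.r e = x <;> by_cases h2 : e ∈ F <;>
          simp [splitPoint, splitDup, outSplit, outTwin, P, h, h1, h2]
      · by_cases h1 : G.r e = x <;>
          simp [splitPoint, splitDup, outSplit, outTwin, h, h1, hF' e h]
    · by_cases h : G.s e = x
      · by_cases h2 : e ∈ F <;> simp [splitPoint, splitDup, outSplit, outTwin, P, h, h2]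
      · simp [splitPoint, splitDup, outSplit, outTwin, h, hF' e h]

theorem inTwin_moveEquiv_of_forall_mem (hG : Finite G.V) {x : G.V} {f : G.E}
    (hf : ∀ e, G.s e = x ↔ e = f) {A : Set G.E} (hA : ∀ e, e ∈ A ↔ G.r e = x) :
    MoveEquiv (G.inTwin x A) G := by
  classical
  have hsrc : (G.inTwin x A).IsSource (some x : Option G.V) := by
    have key : ∀ e, (if e ∈ A then none else some (G.r e)) ≠ some x := by
      intro e h
      by_cases he : e ∈ A
      · simp [he] at h
      · exact he ((hA e).2 (by simpa [he] using h))
    rintro (e | e)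
    · exact key e
    · exact key e.1
  have hxs : ∀ e : G.E ⊕ {e : G.E // G.s e = x},
      (G.inTwin x A).s e = some x ↔ e = .inl f := by
    rintro (e | e)
    · simp [inTwin, hf]
    · simp [inTwin]
  have hfin := finite_inTwin hG x A
  refine (MoveEquiv.moveS hfin _ (regular_of_unique_edge hxs) hsrc
    (nonempty_iso_refl _)).trans (.of_iso
      (inferInstanceAs (Finite {w : (G.inTwin x A).V // w ≠ some x})) ?_)
  have hne : ∀ e (h : (G.inTwin x A).s (.inl e) ≠ some x), G.s e ≠ x :=
    fun e h h' => h (congrArg some h')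
  refine nonempty_iso_of_bijective (fun w => Option.getD w.1 x)
    (fun e => Sum.elim id Subtype.val e.1) ⟨?_, ?_⟩ ⟨?_, ?_⟩ ?_ ?_
  · rintro ⟨_ | a, ha⟩ ⟨_ | b, hb⟩ h
    · rfl
    · exact absurd (congrArg some (show x = b from h).symm) hb
    · exact absurd (congrArg some (show a = x from h)) ha
    · exact Subtype.ext (congrArg some (show a = b from h))
  · intro w
    by_cases h : w = x
    · exact ⟨⟨none, (Option.some_ne_none x).symm⟩, h.symm⟩
    · exact ⟨⟨some w, fun h' => h (Option.some_injective _ h')⟩, rfl⟩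
  · rintro ⟨a | a, ha⟩ ⟨b | b, hb⟩ h
    · exact Subtype.ext (congrArg Sum.inl (show a = b from h))
    · exact absurd ((congrArg G.s (show a = b.1 from h)).trans b.2) (hne a ha)
    · exact absurd ((congrArg G.s (show a.1 = b from h)).symm.trans a.2) (hne b hb)
    · exact Subtype.ext (congrArg Sum.inr (Subtype.ext h))
  · intro e
    by_cases h : G.s e = x
    · exact ⟨⟨.inr ⟨e, h⟩, (Option.some_ne_none x).symm⟩, rfl⟩
    · exact ⟨⟨.inl e, fun h' => h (Option.some_injective _ h')⟩, rfl⟩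
  · have key : ∀ e, G.r e = (if e ∈ A then none else some (G.r e)).getD x := by
      intro e
      by_cases he : e ∈ A
      · simp [he, (hA e).1 he]
      · simp [he]
    rintro ⟨e | e, he⟩
    · exact key e
    · exact key e.1
  · rintro ⟨e | e, he⟩
    · rfl
    · exact e.2

theorem inTwin_moveEquiv_redirect (hG : Finite G.V) {x : G.V} {f : G.E}
    (hf : ∀ e, G.s e = x ↔ e = f) (hrf : G.r f ≠ x) {A : Set G.E}
    (hA : ∀ e ∈ A, G.r e = x) {z : G.V} (hz : ∀ e ∈ A, G.s e = z) :
    MoveEquiv (G.inTwin x A) (G.redirect A (G.r f)) := by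
  classical
  have hfA : f ∉ A := fun h => hrf (hA f h)
  have hr : ∀ e, (if e ∈ A then none else some (G.r e)) = none ↔ e ∈ A := by
    intro e
    by_cases he : e ∈ A <;> simp [he]
  let f' : {e : G.E // G.s e = x} := ⟨f, (hf f).2 rfl⟩
  have hf' : ∀ e, e = f' := fun e => Subtype.ext ((hf e.1).1 e.2)
  have hrf' : (G.inTwin x A).r (.inr f') = some (G.r f) := if_neg hfA
  have hin : ∀ e, (G.inTwin x A).r e = none → (G.inTwin x A).s e = some z := by
    rintro (e | e) h
    · exact congrArg some (hz e ((hr e).1 h))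
    · rw [hf' e, hrf'] at h
      exact absurd h (Option.some_ne_none _)
  have honly : ∀ e, (G.inTwin x A).s e = none → e = .inr f' := by
    rintro (e | e) h
    · exact absurd h (Option.some_ne_none _)
    · rw [hf' e]
  have hrn : (G.inTwin x A).r (.inr f') ≠ none := by
    rw [hrf']
    exact Option.some_ne_none _
  have hrn' : ∀ e, (G.inTwin x A).r (.inr e) ≠ none := fun e => hf' e ▸ hrn
  have hfin := finite_inTwin hG x A
  refine (MoveEquiv.moveR hfin _ (.inr f') rfl hrn honly _ hin
    (nonempty_iso_refl _)).trans (.of_iso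
      (inferInstanceAs (Finite {w : (G.inTwin x A).V // w ≠ none})) ?_)
  refine nonempty_iso_of_bijective (fun w => Option.getD w.1 x)
    (fun e => Sum.elim (fun e => Sum.elim id Subtype.val e.1)
      (fun e => Sum.elim id Subtype.val e.1) e) ⟨?_, ?_⟩ ⟨?_, ?_⟩ ?_ ?_
  · rintro ⟨_ | a, ha⟩ ⟨_ | b, hb⟩ h
    · rfl
    · exact absurd rfl ha
    · exact absurd rfl hb
    · exact Subtype.ext (congrArg some (show a = b from h))
  · intro w
    exact ⟨⟨some w, Option.some_ne_none w⟩, rfl⟩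
  · rintro (⟨a | a, ha, ha'⟩ | ⟨a | a, ha⟩) (⟨b | b, hb, hb'⟩ | ⟨b | b, hb⟩) h
    all_goals first
      | exact absurd (congrArg Sum.inr (hf' a)) ha'
      | exact absurd (congrArg Sum.inr (hf' b)) hb'
      | exact absurd ha (hrn' a)
      | exact absurd hb (hrn' b)
      | obtain rfl : a = b := h
        first
          | rfl
          | exact absurd hb ha
          | exact absurd ha hb
  · intro e
    by_cases h : e ∈ A
    · exact ⟨.inr ⟨.inl e, (hr e).2 h⟩, rfl⟩
    · exact ⟨.inl ⟨.inl e, fun h' => h ((hr e).1 h'), Sum.inl_ne_inr⟩, rfl⟩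
  · rintro (⟨e | e, he, he'⟩ | ⟨e | e, he⟩)
    · have h : e ∉ A := fun h => he ((hr e).2 h)
      simp [reduce, redirect, inTwin, h]
    · exact absurd (congrArg Sum.inr (hf' e)) he'
    · have h : e ∈ A := (hr e).1 he
      simp only [reduce, redirect, Sum.elim_inr, Sum.elim_inl, id, if_pos h]
      exact (congrArg (Option.getD · x) hrf').symm
    · exact absurd he (hrn' e)
  · rintro (⟨e | e, he, he'⟩ | ⟨e | e, he⟩)
    · rfl
    · exact absurd (congrArg Sum.inr (hf' e)) he'
    · rfl
    · exact absurd he (hrn' e)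

theorem redirect_empty (G : CKGraph) (y : G.V) : G.redirect ∅ y = G := by
  simp [redirect]

theorem redirect_redirect (G : CKGraph) (A B : Set G.E) (y : G.V) :
    redirect (G.redirect A y) B y = G.redirect (A ∪ B) y := by
  simp only [redirect, CKGraph.mk.injEq, heq_eq_eq, true_and, and_true]
  funext e
  by_cases h : e ∈ A <;> by_cases h' : e ∈ B <;> simp [Set.mem_union, h, h'] <;> tauto

theorem moveEquiv_redirect_of_source (hG : Finite G.V) {x : G.V} {f : G.E}
    (hf : ∀ e, G.s e = x ↔ e = f) (hrf : G.r f ≠ x) {A : Set G.E}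
    (hA : ∀ e ∈ A, G.r e = x) {z : G.V} (hz : ∀ e ∈ A, G.s e = z) :
    MoveEquiv G (G.redirect A (G.r f)) := by
  obtain rfl | hne := A.eq_empty_or_nonempty
  · rw [redirect_empty]
    exact .refl hG
  · refine MoveEquiv.trans ?_ (inTwin_moveEquiv_redirect hG hf hrf hA hz)
    by_cases hrest : ∃ e, G.r e = x ∧ e ∉ A
    · exact moveEquiv_inTwin hG (regular_of_unique_edge hf) hA hne hrest
    · push Not at hrest
      exact (inTwin_moveEquiv_of_forall_mem hG hf fun e => ⟨hA e, hrest e⟩).symm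

theorem moveEquiv_redirect (hG : Finite G.V) {x : G.V} {f : G.E}
    (hf : ∀ e, G.s e = x ↔ e = f) (hrf : G.r f ≠ x) :
    MoveEquiv G (G.redirect {e | G.r e = x} (G.r f)) := by
  classical
  have key : ∀ Z : Finset G.V,
      MoveEquiv G (G.redirect {e | G.r e = x ∧ G.s e ∈ Z} (G.r f)) := by
    intro Z
    induction Z using Finset.induction_on with
    | empty =>
      have h : {e | G.r e = x ∧ G.s e ∈ (∅ : Finset G.V)} = ∅ := by ext; simp
      rw [h, redirect_empty]
      exact .refl hG
    | insert z Z _ ih =>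
      refine ih.trans ?_
      set A : Set G.E := {e | G.r e = x ∧ G.s e ∈ Z} with hAdef
      set B : Set G.E := {e | G.r e = x ∧ G.s e = z ∧ e ∉ A} with hB
      have hfA : f ∉ A := fun h => hrf h.1
      have hrf' : (G.redirect A (G.r f)).r f = G.r f := if_neg hfA
      have := moveEquiv_redirect_of_source (G := G.redirect A (G.r f)) hG (x := x) (f := f) hf
        (by rw [hrf']; exact hrf) (A := B) (fun e he => (if_neg he.2.2).trans he.1) (z := z)
        (fun e he => he.2.1)
      rw [hrf'] at this
      convert this using 1
      refine Eq.trans ?_ (redirect_redirect G A B (G.r f)).symm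
      congr 1
      ext e
      simp only [Finset.mem_insert, Set.mem_union, Set.mem_ofPred_eq, hAdef, hB]
      tauto
  have := Fintype.ofFinite G.V
  simpa using key Finset.univ

theorem moveEquiv_collapseOne (hG : Finite G.V) {x : G.V} {f : G.E}
    (hf : G.s f = x) (honly : ∀ e, G.s e = x → e = f) (hrf : G.r f ≠ x) :
    MoveEquiv G (G.collapseOne x f hf honly hrf) := by
  have hf' : ∀ e, G.s e = x ↔ e = f := fun e => ⟨honly e, fun h => h ▸ hf⟩
  refine (moveEquiv_redirect hG hf' hrf).trans ?_
  have hsrc : (G.redirect {e | G.r e = x} (G.r f)).IsSource x := by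
    intro e h
    by_cases he : G.r e = x <;> simp [redirect, he] at h
    exact hrf h
  let ψ₁ : {e : G.E // G.r e ≠ x ∧ e ≠ f} → {e : G.E // G.s e ≠ x} :=
    fun e => ⟨e.1, fun h => e.2.2 (honly e.1 h)⟩
  let ψ₂ : {e : G.E // G.r e = x} → {e : G.E // G.s e ≠ x} :=
    fun e => ⟨e.1, fun h => hrf (honly e.1 h ▸ e.2)⟩
  refine .moveS (G := G.redirect {e | G.r e = x} (G.r f)) hG x
    (regular_of_unique_edge (G := G.redirect {e | G.r e = x} (G.r f)) hf') hsrc ?_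
  refine nonempty_iso_of_bijective (fun w => w)
    (Sum.elim ψ₁ ψ₂) Function.bijective_id ⟨?_, ?_⟩ ?_ ?_
  · rintro (⟨a, ha⟩ | ⟨a, ha⟩) (⟨b, hb⟩ | ⟨b, hb⟩) h
    all_goals
      obtain rfl : a = b := congrArg Subtype.val h
      first
        | rfl
        | exact absurd hb ha.1
        | exact absurd ha hb.1
  · rintro ⟨e, he⟩
    by_cases h : G.r e = x
    · exact ⟨.inr ⟨e, h⟩, rfl⟩
    · exact ⟨.inl ⟨e, h, fun h' => he ((hf' e).2 h')⟩, rfl⟩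
  · rintro (⟨e, he⟩ | ⟨e, he⟩)
    · simp [removeSource, redirect, collapseOne, ψ₁, he.1]
    · simp [removeSource, redirect, collapseOne, ψ₂, he]
  · rintro (⟨e, he⟩ | ⟨e, he⟩) <;> rfl

/-- The graph `G` with the edge `f` deleted and, for each edge `e` into `s f`, a new edge
from `s e` to `r f`. -/
def bypass (G : CKGraph) (f : G.E) : CKGraph where
  V := G.V
  E := {e : G.E // e ≠ f} ⊕ {e : G.E // G.r e = G.s f}
  r
    | .inl e => G.r e.1
    | .inr _ => G.r f
  s
    | .inl e => G.s e.1
    | .inr e => G.s e.1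

theorem moveEquiv_bypass (hG : Finite G.V) {f : G.E} (hf : G.r f ≠ G.s f)
    (hrest : ∃ e, G.s e = G.s f ∧ e ≠ f) : MoveEquiv G (G.bypass f) := by
  have hne : ∀ e : {e : G.E // G.r e = G.s f}, e.1 ≠ f :=
    fun e h => hf ((congrArg G.r h).symm.trans e.2)
  refine (moveEquiv_outTwin hG (x := G.s f) (F := {f}) (by simp) (by simp) (by simp)
    hrest).trans ?_
  have hs : (G.outTwin (G.s f) {f}).s (.inl f) = none := if_pos rfl
  have hs' : ∀ e, e ≠ f → (G.outTwin (G.s f) {f}).s (.inl e) = some (G.s e) :=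
    fun e h => if_neg h
  have honly : ∀ e, (G.outTwin (G.s f) {f}).s e = none → e = .inl f := by
    rintro (e | e) h
    · by_contra he
      exact Option.some_ne_none _ ((hs' e fun h' => he (congrArg _ h')).symm.trans h)
    · exact absurd ((hs' e.1 (hne e)).symm.trans h) (Option.some_ne_none _)
  have hr : (G.outTwin (G.s f) {f}).r (.inl f) ≠ none := Option.some_ne_none _
  have hfin := finite_outTwin hG (G.s f) {f}
  refine (moveEquiv_collapseOne hfin hs honly hr).trans
    (MoveEquiv.of_iso (G := G.bypass f) hG ?_).symm
  refine nonempty_iso_of_bijective (fun w => ⟨some w, Option.some_ne_none w⟩)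
    (fun e => Sum.elim
      (fun e => .inl ⟨.inl e.1, Option.some_ne_none _, fun h => e.2 (Sum.inl_injective h)⟩)
      (fun e => .inr ⟨.inr e, rfl⟩) e) ⟨?_, ?_⟩ ⟨?_, ?_⟩ ?_ ?_
  · intro a b h
    exact Option.some_injective _ (congrArg Subtype.val h)
  · rintro ⟨_ | w, hw⟩
    · exact absurd rfl hw
    · exact ⟨w, rfl⟩
  · rintro (a | a) (b | b) h
    · exact congrArg _ (Subtype.ext (Sum.inl_injective (congrArg Subtype.val
        (Sum.inl_injective h))))
    · exact absurd h Sum.inl_ne_inr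
    · exact absurd h Sum.inr_ne_inl
    · exact congrArg _ (Sum.inr_injective (congrArg Subtype.val (Sum.inr_injective h)))
  · rintro (⟨e | e, he, he'⟩ | ⟨e | e, he⟩)
    · exact ⟨.inl ⟨e, fun h => he' (congrArg _ h)⟩, rfl⟩
    · exact absurd rfl he
    · exact absurd he (Option.some_ne_none _)
    · exact ⟨.inr e, rfl⟩
  · rintro (e | e) <;> rfl
  · rintro (e | e)
    · exact Subtype.ext (hs' e.1 e.2)
    · exact Subtype.ext (hs' e.1 (hne e))

end Moves

end CKGraph

open Relation

namespace CKGraph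

/-- There is an edge from `u` to `v`. -/
def Adj (G : CKGraph) (u v : G.V) : Prop := ∃ e, G.s e = u ∧ G.r e = v

/-- There are infinitely many edges from `u` to `v`. -/
def InfAdj (G : CKGraph) (u v : G.V) : Prop := {e | G.s e = u ∧ G.r e = v}.Infinite

/-- Any two vertices are connected by a nonempty path. -/
def StronglyConnected (G : CKGraph) : Prop := ∀ u v, TransGen G.Adj u v

section Basic

variable {G : CKGraph}

theorem adj_edge (e : G.E) : G.Adj (G.s e) (G.r e) := ⟨e, rfl, rfl⟩

theorem hasPath_iff_transGen {u v : G.V} : G.HasPath u v ↔ TransGen G.Adj u v := by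
  constructor
  · intro h
    induction h with
    | single e => exact .single (adj_edge e)
    | cons e _ ih => exact .head (adj_edge e) ih
  · intro h
    induction h using TransGen.head_induction_on with
    | single h =>
      obtain ⟨e, rfl, rfl⟩ := h
      exact .single e
    | head h _ ih =>
      obtain ⟨e, rfl, rfl⟩ := h
      exact .cons e ih

theorem geq_iff_reflTransGen {u v : G.V} : G.Geq u v ↔ ReflTransGen G.Adj u v := by
  rw [Geq, hasPath_iff_transGen, reflTransGen_iff_eq_or_transGen, eq_comm]

theorem StronglyConnected.exists_adj_left (h : G.StronglyConnected) (v : G.V) :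
    ∃ w, G.Adj v w :=
  let ⟨w, hw, _⟩ := TransGen.head'_iff.1 (h v v)
  ⟨w, hw⟩

theorem StronglyConnected.regular (h : G.StronglyConnected) {v : G.V}
    (hv : ¬ G.IsInfiniteEmitter v) : G.Regular v :=
  let ⟨_, e, he, _⟩ := h.exists_adj_left v
  ⟨⟨e, he⟩, Set.not_infinite.1 hv⟩

theorem Regular.not_isInfiniteEmitter {v : G.V} (h : G.Regular v) :
    ¬ G.IsInfiniteEmitter v :=
  Set.not_infinite.2 h.2

theorem InfAdj.adj {u v : G.V} (h : G.InfAdj u v) : G.Adj u v := h.nonempty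

theorem IsInfiniteEmitter.exists_infAdj [Finite G.V] {u : G.V}
    (hu : G.IsInfiniteEmitter u) : ∃ v, G.InfAdj u v := by
  by_contra! h
  refine hu ((Set.finite_iUnion fun v => Set.not_infinite.1 (h v)).subset ?_)
  intro e he
  exact Set.mem_iUnion.2 ⟨G.r e, he, rfl⟩

theorem finite_of_finite_preimages {α β : Type*} {S : Set (α ⊕ β)}
    (h₁ : (Sum.inl ⁻¹' S).Finite) (h₂ : (Sum.inr ⁻¹' S).Finite) : S.Finite := by
  refine ((h₁.image Sum.inl).union (h₂.image Sum.inr)).subset ?_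
  rintro (a | b) h
  · exact .inl ⟨a, h, rfl⟩
  · exact .inr ⟨b, h, rfl⟩

end Basic

section Sources

theorem adj_removeSource {G : CKGraph} {v : G.V} (hsrc : G.IsSource v)
    {a b : (G.removeSource v hsrc).V} :
    (G.removeSource v hsrc).Adj a b ↔ G.Adj a.1 b.1 := by
  constructor
  · rintro ⟨e, rfl, rfl⟩
    exact ⟨e.1, rfl, rfl⟩
  · rintro ⟨e, he, he'⟩
    exact ⟨⟨e, he ▸ a.2⟩, Subtype.ext he, Subtype.ext he'⟩

theorem reflTransGen_removeSource {G : CKGraph} {v : G.V} (hsrc : G.IsSource v)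
    {a b : (G.removeSource v hsrc).V} (h : ReflTransGen G.Adj a.1 b.1) :
    ReflTransGen (G.removeSource v hsrc).Adj a b := by
  obtain ⟨b, hb⟩ := b
  change ReflTransGen G.Adj a.1 b at h
  induction h with
  | refl => exact .refl
  | @tail c d _ hcd ih =>
    by_cases hc : c = v
    · subst hc
      obtain h | ⟨_, _, e, _, he⟩ := (‹ReflTransGen G.Adj a.1 c›).cases_tail
      · exact absurd h.symm a.2
      · exact absurd he (hsrc e)
    · exact (ih hc).tail ((adj_removeSource hsrc).2 hcd)

theorem exists_cycle_of_forall_adj {α : Type*} [Finite α] {R : α → α → Prop}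
    (h : ∀ a, ∃ b, R b a) (a : α) : ∃ b, TransGen R b b ∧ ReflTransGen R b a := by
  choose p hp using h
  have hle : ∀ n b, ReflTransGen R (p^[n] b) b := by
    intro n
    induction n with
    | zero => exact fun b => .refl
    | succ n ih => exact fun b => (ih (p b)).tail (hp b)
  obtain ⟨i, j, hij, heq⟩ := Finite.exists_ne_map_eq_of_infinite fun n : ℕ => p^[n] a
  wlog hlt : i < j generalizing i j
  · exact this j i hij.symm heq.symm (by omega)
  refine ⟨p^[i] a, ?_, hle i a⟩
  obtain ⟨k, rfl⟩ := Nat.exists_eq_add_of_lt hlt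
  have h1 : p^[k] (p (p^[i] a)) = p^[i] a := by
    rw [← Function.iterate_succ_apply, ← Function.iterate_add_apply]
    exact (congrArg (fun n => p^[n] a) (by omega)).trans heq.symm
  have h2 := TransGen.tail' (hle k (p (p^[i] a))) (hp (p^[i] a))
  rwa [h1] at h2

theorem exists_moveEquiv_stronglyConnected {G : CKGraph} (hfin : Finite G.V)
    (hsink : ∀ v, ∃ e, G.s e = v)
    (hreach : ∀ v w, TransGen G.Adj w w ∨ G.IsInfiniteEmitter w → ReflTransGen G.Adj v w) :
    ∃ H : CKGraph, Finite H.V ∧ H.StronglyConnected ∧ MoveEquiv G H := by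
  induction hn : Nat.card G.V using Nat.strong_induction_on generalizing G with
  | _ n ih =>
  by_cases h : ∃ v, G.IsSource v
  · obtain ⟨v, hsrc⟩ := h
    have hreg : G.Regular v := by
      refine ⟨hsink v, Set.not_infinite.1 fun hinf => ?_⟩
      obtain ⟨e, he⟩ := hsink v
      obtain h | h := reflTransGen_iff_eq_or_transGen.1 (hreach (G.r e) v (.inr hinf))
      · exact hsrc e h.symm
      · obtain ⟨_, _, e', _, he'⟩ := TransGen.tail'_iff.1 h
        exact hsrc e' he'
    have hfin' : Finite (G.removeSource v hsrc).V :=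
      inferInstanceAs (Finite {w : G.V // w ≠ v})
    obtain ⟨H, hH, hsc, hm⟩ := ih _ (by
      rw [← hn]
      exact Finite.card_subtype_lt (p := fun w => w ≠ v) (x := v) (by simp)) hfin' (by
        rintro ⟨w, hw⟩
        obtain ⟨e, rfl⟩ := hsink w
        exact ⟨⟨e, hw⟩, rfl⟩) (by
        intro a w hw
        refine reflTransGen_removeSource hsrc (hreach a.1 w.1 (hw.imp ?_ ?_))
        · exact fun h => TransGen.lift Subtype.val (fun _ _ => (adj_removeSource hsrc).1) _ _ h
        · intro hinf hfin
          refine hinf ((hfin.preimage Subtype.val_injective.injOn).subset ?_)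
          exact fun e he => congrArg Subtype.val he) rfl
    exact ⟨H, hH, hsc, (MoveEquiv.moveS hfin v hreg hsrc (nonempty_iso_refl _)).trans hm⟩
  · refine ⟨G, hfin, fun v w => ?_, .refl hfin⟩
    obtain ⟨c, hc, hcw⟩ := exists_cycle_of_forall_adj (R := G.Adj) (fun a => by
      by_contra! ha
      exact h ⟨a, fun e he => ha (G.s e) ⟨e, rfl, he⟩⟩) w
    exact (TransGen.trans_right (hreach v c (.inl hc)) hc).trans_left hcw

theorem reflTransGen_of_simple {G : CKGraph}
    (hsimple : ∀ H : Set G.V, G.Hereditary H → G.Saturated H → H = ∅ ∨ H = Set.univ)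
    {v w : G.V} (hw : TransGen G.Adj w w ∨ G.IsInfiniteEmitter w) :
    ReflTransGen G.Adj v w := by
  let H : Set G.V := {a | ∀ c, ReflTransGen G.Adj a c →
    TransGen G.Adj c c ∨ G.IsInfiniteEmitter c → ReflTransGen G.Adj v c}
  have hv : v ∈ H := fun c hc _ => hc
  have hH : H = ∅ ∨ H = Set.univ := by
    refine hsimple H (fun e he c hc => he c (.head (adj_edge e) hc)) fun a ha hsucc c hc hc' => ?_
    obtain rfl | ⟨b, ⟨e, he, rfl⟩, hbc⟩ := hc.cases_head
    · obtain hloop | hinf := hc'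
      · obtain ⟨b, ⟨e, he, rfl⟩, hba⟩ := TransGen.head'_iff.1 hloop
        exact hsucc e he a hba (.inl hloop)
      · exact absurd hinf ha.not_isInfiniteEmitter
    · exact hsucc e he c hbc hc'
  obtain hH | hH := hH
  · rw [hH] at hv
    exact hv.elim
  · have hwH : w ∈ H := hH ▸ Set.mem_univ w
    exact hwH w .refl hw

end Sources

section Bypass

variable {G : CKGraph} {f : G.E}

theorem adj_bypass_of_ne {e : G.E} (he : e ≠ f) : (G.bypass f).Adj (G.s e) (G.r e) :=
  ⟨.inl ⟨e, he⟩, rfl, rfl⟩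

theorem adj_bypass_of_r_eq {e : G.E} (he : G.r e = G.s f) :
    (G.bypass f).Adj (G.s e) (G.r f) :=
  ⟨.inr ⟨e, he⟩, rfl, rfl⟩

theorem StronglyConnected.bypass (h : G.StronglyConnected) (hf : G.r f ≠ G.s f)
    (hrest : ∃ e, G.s e = G.s f ∧ e ≠ f) : (G.bypass f).StronglyConnected := by
  have key : ∀ a b, TransGen G.Adj a b → TransGen (G.bypass f).Adj a b ∨
      (a = G.s f ∧ ReflTransGen (G.bypass f).Adj (G.r f) b) := by
    intro a b hab
    induction hab using TransGen.head_induction_on with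
    | single hac =>
      obtain ⟨e, rfl, rfl⟩ := hac
      by_cases he : e = f
      · subst he
        exact .inr ⟨rfl, .refl⟩
      · exact .inl (.single (adj_bypass_of_ne he))
    | head hac _ ih =>
      obtain ⟨e, rfl, rfl⟩ := hac
      by_cases he : e = f
      · subst he
        exact .inr ⟨rfl, ih.elim TransGen.to_reflTransGen fun h => absurd h.1 hf⟩
      · obtain ih | ⟨ih, ih'⟩ := ih
        · exact .inl (.head (adj_bypass_of_ne he) ih)
        · exact .inl (.head' (adj_bypass_of_r_eq ih) ih')
  intro a b
  obtain hab | ⟨rfl, hab⟩ := key a b (h a b)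
  · exact hab
  · obtain ⟨e, hes, hef⟩ := hrest
    rw [← hes]
    obtain h' | ⟨h', -⟩ := key _ b (h (G.r e) b)
    · exact .head (adj_bypass_of_ne hef) h'
    · exact .head' (adj_bypass_of_r_eq h') hab

theorem isInfiniteEmitter_of_bypass {v : G.V} (h : (G.bypass f).IsInfiniteEmitter v) :
    G.IsInfiniteEmitter v := fun hfin => h <| finite_of_finite_preimages
  ((hfin.preimage Subtype.val_injective.injOn).subset fun _ he => he)
  ((hfin.preimage Subtype.val_injective.injOn).subset fun _ he => he)

theorem InfAdj.bypass {u v : G.V} (h : G.InfAdj u v) : (G.bypass f).InfAdj u v := by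
  intro hfin
  refine h ((((hfin.preimage Sum.inl_injective.injOn).image Subtype.val).union
    (Set.finite_singleton f)).subset ?_)
  intro e he
  by_cases hef : e = f
  · exact .inr hef
  · exact .inl ⟨⟨e, hef⟩, he, rfl⟩

theorem InfAdj.bypass_r {u : G.V} (h : G.InfAdj u (G.s f)) :
    (G.bypass f).InfAdj u (G.r f) := by
  intro hfin
  refine h (((hfin.preimage Sum.inr_injective.injOn).image Subtype.val).subset ?_)
  intro e he
  exact ⟨⟨e, he.2⟩, ⟨he.1, rfl⟩, rfl⟩

theorem IsInfiniteEmitter.bypass [Finite G.V] {u : G.V} (h : G.IsInfiniteEmitter u) :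
    (G.bypass f).IsInfiniteEmitter u :=
  let ⟨_, hv⟩ := h.exists_infAdj
  (hv.bypass (f := f)).mono fun _ he => he.1

theorem StronglyConnected.collapseOne (h : G.StronglyConnected) {x : G.V} (hf : G.s f = x)
    (honly : ∀ e, G.s e = x → e = f) (hrf : G.r f ≠ x) :
    (G.collapseOne x f hf honly hrf).StronglyConnected := by
  set K := G.collapseOne x f hf honly hrf with hK
  have hne : ∀ e (he : G.r e = x), G.s e ≠ x := by
    intro e he h'
    rw [honly e h'] at he
    exact hrf he
  have key : ∀ a b (hb : b ≠ x), TransGen G.Adj a b →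
      (∀ ha : a ≠ x, TransGen K.Adj ⟨a, ha⟩ ⟨b, hb⟩) ∧
      (a = x → ReflTransGen K.Adj ⟨G.r f, hrf⟩ ⟨b, hb⟩) := by
    intro a b hb hab
    induction hab using TransGen.head_induction_on with
    | single hac =>
      obtain ⟨e, rfl, rfl⟩ := hac
      refine ⟨fun ha => .single ⟨.inl ⟨e, hb, fun h' => ha (h' ▸ hf)⟩, rfl, rfl⟩, fun ha => ?_⟩
      obtain rfl := honly e ha
      exact .refl
    | head hac _ ih =>
      obtain ⟨e, rfl, rfl⟩ := hac
      refine ⟨fun ha => ?_, fun ha => ?_⟩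
      · by_cases hc : G.r e = x
        · exact .head' (b := ⟨G.r f, hrf⟩) ⟨.inr ⟨e, hc⟩, rfl, rfl⟩ (ih.2 hc)
        · exact .head (b := ⟨G.r e, hc⟩) ⟨.inl ⟨e, hc, fun h' => ha (h' ▸ hf)⟩, rfl, rfl⟩
            (ih.1 hc)
      · obtain rfl := honly e ha
        exact (ih.1 hrf).to_reflTransGen
  rintro ⟨a, ha⟩ ⟨b, hb⟩
  exact (key a b hb (h a b)).1 ha

theorem exists_moveEquiv_card_lt {G : CKGraph} (hfin : Finite G.V)
    (hsc : G.StronglyConnected) {x : G.V} (hx : G.Regular x) (hloop : ¬ G.Adj x x) :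
    ∃ H : CKGraph, Finite H.V ∧ H.StronglyConnected ∧ Nat.card H.V < Nat.card G.V ∧
      MoveEquiv G H := by
  induction hn : {e | G.s e = x}.ncard using Nat.strong_induction_on generalizing G with
  | _ n ih =>
  obtain ⟨⟨f, rfl⟩, hfin_x⟩ := hx
  have hrf : G.r f ≠ G.s f := fun h => hloop ⟨f, rfl, h⟩
  by_cases hrest : ∃ e, G.s e = G.s f ∧ e ≠ f
  · have hmove := moveEquiv_bypass hfin hrf hrest
    have hsc' := hsc.bypass hrf hrest
    have hloop' : ¬ (G.bypass f).Adj (G.s f) (G.s f) := by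
      rintro ⟨e | e, he, he'⟩
      · exact hloop ⟨e.1, he, he'⟩
      · exact hrf he'
    obtain ⟨H, hH, hHsc, hlt, hm⟩ := ih _ (by
      rw [← hn]
      refine (Set.ncard_le_ncard_of_injOn (t := {e | G.s e = G.s f} \ {f})
        (Sum.elim Subtype.val Subtype.val) ?_ ?_ hfin_x.sdiff).trans_lt
          (Set.ncard_sdiff_singleton_lt_of_mem rfl hfin_x)
      · rintro (e | e) he
        · exact ⟨he, e.2⟩
        · exact absurd ⟨e.1, he, e.2⟩ hloop
      · rintro (a | a) ha (b | b) hb hab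
        · exact congrArg _ (Subtype.ext hab)
        · exact absurd ⟨b.1, hb, b.2⟩ hloop
        · exact absurd ⟨a.1, ha, a.2⟩ hloop
        · exact congrArg _ (Subtype.ext hab)) (G := G.bypass f) hfin hsc'
        (hsc'.regular fun h => isInfiniteEmitter_of_bypass h hfin_x) hloop' rfl
    exact ⟨H, hH, hHsc, hlt, hmove.trans hm⟩
  · push Not at hrest
    exact ⟨_, inferInstanceAs (Finite {w : G.V // w ≠ G.s f}),
      hsc.collapseOne rfl hrest hrf,
      Finite.card_subtype_lt (p := fun w => w ≠ G.s f) (x := G.s f) (by simp),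
      moveEquiv_collapseOne hfin rfl hrest hrf⟩

theorem exists_moveEquiv_loops {G : CKGraph} (hfin : Finite G.V)
    (hsc : G.StronglyConnected) :
    ∃ H : CKGraph, Finite H.V ∧ H.StronglyConnected ∧ (∀ v, H.Regular v → H.Adj v v) ∧
      MoveEquiv G H := by
  induction hn : Nat.card G.V using Nat.strong_induction_on generalizing G with
  | _ n ih =>
  by_cases h : ∀ v, G.Regular v → G.Adj v v
  · exact ⟨G, hfin, hsc, h, .refl hfin⟩
  · push Not at h
    obtain ⟨x, hx, hloop⟩ := h
    obtain ⟨H, hH, hHsc, hlt, hm⟩ := exists_moveEquiv_card_lt hfin hsc hx hloop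
    obtain ⟨K, hK, hKsc, hKloop, hm'⟩ := ih _ (hn ▸ hlt) hH hHsc rfl
    exact ⟨K, hK, hKsc, hKloop, hm.trans hm'⟩

theorem exists_moveEquiv_infAdj {G : CKGraph} (hfin : Finite G.V)
    (hsc : G.StronglyConnected) (hloop : ∀ v, G.Regular v → G.Adj v v) :
    ∃ H : CKGraph, Finite H.V ∧ H.StronglyConnected ∧ (∀ v, H.Regular v → H.Adj v v) ∧
      (∀ u, H.IsInfiniteEmitter u → ∀ v, H.InfAdj u v) ∧ MoveEquiv G H := by
  induction hn : {p : G.V × G.V | G.IsInfiniteEmitter p.1 ∧ ¬ G.InfAdj p.1 p.2}.ncard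
    using Nat.strong_induction_on generalizing G with
  | _ n ih =>
  by_cases h : ∀ u, G.IsInfiniteEmitter u → ∀ v, G.InfAdj u v
  · exact ⟨G, hfin, hsc, hloop, h, .refl hfin⟩
  push Not at h
  obtain ⟨u, hu, w, hw⟩ := h
  obtain ⟨f, hf, hf'⟩ : ∃ f, G.InfAdj u (G.s f) ∧ ¬ G.InfAdj u (G.r f) := by
    by_contra! h
    obtain ⟨x, hx⟩ := hu.exists_infAdj
    have key : ∀ c, TransGen G.Adj x c → G.InfAdj u c := by
      intro c hc
      induction hc with
      | single hxc =>
        obtain ⟨e, rfl, rfl⟩ := hxc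
        exact h e hx
      | tail _ hcd ih =>
        obtain ⟨e, rfl, rfl⟩ := hcd
        exact h e ih
    exact hw (key w (hsc x w))
  have hrf : G.r f ≠ G.s f := fun h => hf' (h ▸ hf)
  have hrest : ∃ e, G.s e = G.s f ∧ e ≠ f := by
    by_cases hinf : G.IsInfiniteEmitter (G.s f)
    · exact hinf.exists_notMem_finite (Set.finite_singleton f)
    · obtain ⟨e, he, he'⟩ := hloop _ (hsc.regular hinf)
      exact ⟨e, he, fun h => hrf (h ▸ he')⟩
  have hmove := moveEquiv_bypass hfin hrf hrest
  have hloop' : ∀ v, (G.bypass f).Regular v → (G.bypass f).Adj v v := by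
    intro v hv
    obtain ⟨e, he, he'⟩ := hloop v
      (hsc.regular fun h => hv.not_isInfiniteEmitter h.bypass)
    have hef : e ≠ f := by
      rintro rfl
      exact hrf (he'.trans he.symm)
    exact ⟨.inl ⟨e, hef⟩, he, he'⟩
  obtain ⟨H, hH, hHsc, hHloop, hHinf, hm⟩ := ih _ (by
    rw [← hn]
    refine Set.ncard_lt_ncard ⟨fun p hp => ⟨isInfiniteEmitter_of_bypass hp.1,
      fun h => hp.2 h.bypass⟩, fun hsub => ?_⟩
      (Set.toFinite (α := G.V × G.V) _)
    exact (hsub (show (u, G.r f) ∈ _ from ⟨hu, hf'⟩)).2 hf.bypass_r) (G := G.bypass f) hfin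
    (hsc.bypass hrf hrest) hloop' rfl
  exact ⟨H, hH, hHsc, hHloop, hHinf, hmove.trans hm⟩

end Bypass

section OutTwin

/-- The vertex `v` has a regular companion, which receives an edge from every vertex that
emits an edge to `v` and emits an edge to every vertex. -/
def HasRegularTwin (G : CKGraph) (v : G.V) : Prop :=
  ∃ t, G.Regular t ∧ (∀ a, G.Adj a v → G.Adj a t) ∧ ∀ w, G.Adj t w

theorem exists_moveEquiv_hasRegularTwin {G : CKGraph} (hfin : Finite G.V)
    (hsc : G.StronglyConnected) (hloop : ∀ v, G.Adj v v)
    (hinf : ∀ u, G.IsInfiniteEmitter u → ∀ v, G.InfAdj u v) :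
    ∃ H : CKGraph, Finite H.V ∧ H.StronglyConnected ∧ (∀ v, H.Adj v v) ∧
      (∀ u, H.IsInfiniteEmitter u → ∀ v, H.InfAdj u v) ∧
      (∀ u, H.IsInfiniteEmitter u → H.HasRegularTwin u) ∧ MoveEquiv G H := by
  induction hn : {u | G.IsInfiniteEmitter u ∧ ¬ G.HasRegularTwin u}.ncard
    using Nat.strong_induction_on generalizing G with
  | _ n ih =>
  by_cases h : ∀ u, G.IsInfiniteEmitter u → G.HasRegularTwin u
  · exact ⟨G, hfin, hsc, hloop, hinf, h, .refl hfin⟩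
  push Not at h
  obtain ⟨u, hu, hnt⟩ := h
  choose g hg using fun w => (hinf u hu w).adj
  set F : Set G.E := Set.range g with hF
  have hFs : ∀ e ∈ F, G.s e = u := by
    rintro _ ⟨w, rfl⟩
    exact (hg w).1
  have hFfin : F.Finite := Set.finite_range g
  have hmove : MoveEquiv G (G.outTwin u F) :=
    moveEquiv_outTwin hfin hFs ⟨g u, u, rfl⟩ hFfin (hu.exists_notMem_finite hFfin)
  set K := G.outTwin u F with hK
  have hKfin : Finite K.V := finite_outTwin hfin u F
  let ι : G.V → K.V := some
  let t : K.V := (none : Option G.V)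
  have hcases : ∀ a : K.V, a = t ∨ ∃ v, a = ι v := by
    rintro (_ | v)
    · exact .inl rfl
    · exact .inr ⟨v, rfl⟩
  have hs : ∀ e, e ∉ F → K.s (.inl e) = ι (G.s e) := fun e he => if_neg he
  have hs' : ∀ e : {e : G.E // G.r e = u}, e.1 ∉ F → K.s (.inr e) = ι (G.s e.1) :=
    fun e he => if_neg he
  have hsF : ∀ e ∈ F, K.s (.inl e) = t := fun e he => if_pos he
  have hsF' : ∀ e : {e : G.E // G.r e = u}, e.1 ∈ F → K.s (.inr e) = t :=
    fun e he => if_pos he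
  have hs_some : ∀ e v, K.s (.inl e) = ι v → G.s e = v ∧ e ∉ F := by
    intro e v h
    by_cases he : e ∈ F
    · exact absurd ((hsF e he).symm.trans h) (Option.some_ne_none _).symm
    · exact ⟨Option.some_injective _ ((hs e he).symm.trans h), he⟩
  have hs_some' : ∀ (e : {e : G.E // G.r e = u}) v, K.s (.inr e) = ι v → G.s e.1 = v := by
    intro e v h
    by_cases he : e.1 ∈ F
    · exact absurd ((hsF' e he).symm.trans h) (Option.some_ne_none _).symm
    · exact Option.some_injective _ ((hs' e he).symm.trans h)
  have hs_none : ∀ e, K.s (.inl e) = t → e ∈ F := by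
    intro e h
    by_contra he
    exact Option.some_ne_none _ ((hs e he).symm.trans h)
  have hs_none' : ∀ e : {e : G.E // G.r e = u}, K.s (.inr e) = t → e.1 ∈ F := by
    intro e h
    by_contra he
    exact Option.some_ne_none _ ((hs' e he).symm.trans h)
  have ht : ∀ a, K.Adj t a := by
    intro a
    obtain rfl | ⟨v, rfl⟩ := hcases a
    · exact ⟨.inr ⟨g u, (hg u).2⟩, hsF' _ ⟨u, rfl⟩, rfl⟩
    · exact ⟨.inl (g v), hsF _ ⟨v, rfl⟩, congrArg some (hg v).2⟩
  have htreg : K.Regular t := by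
    obtain ⟨e, he, -⟩ := ht t
    exact ⟨⟨e, he⟩, finite_of_finite_preimages (hFfin.subset hs_none)
      ((hFfin.preimage Subtype.val_injective.injOn).subset hs_none')⟩
  have hinfAdj : ∀ a b, G.InfAdj a b → K.InfAdj (ι a) (ι b) := by
    intro a b hab hfin'
    refine hab (((hfin'.preimage Sum.inl_injective.injOn).union hFfin).subset ?_)
    intro e he
    by_cases heF : e ∈ F
    · exact .inr heF
    · exact .inl ⟨(hs e heF).trans (congrArg some he.1), congrArg some he.2⟩
  have hinfAdj' : ∀ a, G.InfAdj a u → K.InfAdj (ι a) t := by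
    intro a ha hfin'
    refine ha ((((hfin'.preimage Sum.inr_injective.injOn).image Subtype.val).union
      hFfin).subset ?_)
    intro e he
    by_cases heF : e ∈ F
    · exact .inr heF
    · exact .inl ⟨⟨e, he.2⟩, ⟨(hs' _ heF).trans (congrArg some he.1), rfl⟩, rfl⟩
  have hemit : ∀ v, K.IsInfiniteEmitter (ι v) → G.IsInfiniteEmitter v := by
    intro v hv hfin'
    exact hv (finite_of_finite_preimages (hfin'.subset fun e he => (hs_some e v he).1)
      ((hfin'.preimage Subtype.val_injective.injOn).subset fun e he => hs_some' e v he))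
  have hadj : ∀ a b, G.Adj a b → K.Adj (ι a) (ι b) := by
    intro a b hab
    by_cases ha : a = u
    · subst ha
      exact (hinfAdj _ _ (hinf a hu b)).adj
    · obtain ⟨e, rfl, rfl⟩ := hab
      exact ⟨.inl e, hs e fun he => ha (hFs e he), rfl⟩
  have hadj' : ∀ a, G.Adj a u → K.Adj (ι a) t := by
    intro a hau
    by_cases ha : a = u
    · subst ha
      exact (hinfAdj' _ (hinf a hu a)).adj
    · obtain ⟨e, rfl, he⟩ := hau
      exact ⟨.inr ⟨e, he⟩, hs' _ fun he => ha (hFs e he), rfl⟩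
  have hadj_some : ∀ a b, K.Adj (ι a) (ι b) → G.Adj a b := by
    rintro a b ⟨e | e, he, he'⟩
    · exact ⟨e, (hs_some e a he).1, Option.some_injective _ he'⟩
    · exact absurd he' (Option.some_ne_none _).symm
  have hKsc : K.StronglyConnected := by
    have h1 : ∀ a b, TransGen K.Adj (ι a) (ι b) := fun a b =>
      TransGen.lift ι hadj _ _ (hsc a b)
    intro a b
    obtain rfl | ⟨a, rfl⟩ := hcases a
    · exact .single (ht b)
    · obtain rfl | ⟨b, rfl⟩ := hcases b
      · exact (h1 a u).tail (hadj' u (hloop u))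
      · exact h1 a b
  have hKloop : ∀ v, K.Adj v v := by
    intro a
    obtain rfl | ⟨a, rfl⟩ := hcases a
    · exact ht _
    · exact hadj a a (hloop a)
  have hKinf : ∀ v, K.IsInfiniteEmitter v → ∀ w, K.InfAdj v w := by
    intro v hv w
    obtain rfl | ⟨v, rfl⟩ := hcases v
    · exact absurd hv htreg.not_isInfiniteEmitter
    · obtain rfl | ⟨w, rfl⟩ := hcases w
      · exact hinfAdj' v (hinf v (hemit v hv) u)
      · exact hinfAdj v w (hinf v (hemit v hv) w)
  have hu' : K.HasRegularTwin (ι u) := by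
    refine ⟨t, htreg, fun a ha => ?_, ht⟩
    obtain rfl | ⟨a, rfl⟩ := hcases a
    · exact ht t
    · exact hadj' a (hadj_some a u ha)
  have htwin : ∀ v, G.HasRegularTwin v → K.HasRegularTwin (ι v) := by
    rintro v ⟨t₀, hreg, hin, hout⟩
    refine ⟨ι t₀, hKsc.regular fun h => hreg.not_isInfiniteEmitter (hemit _ h), fun a ha => ?_,
      fun w => ?_⟩
    · obtain rfl | ⟨a, rfl⟩ := hcases a
      · exact ht _
      · exact hadj _ _ (hin a (hadj_some a v ha))
    · obtain rfl | ⟨w, rfl⟩ := hcases w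
      · exact hadj' _ (hout u)
      · exact hadj _ _ (hout w)
  obtain ⟨H, hH⟩ := ih _ (by
    rw [← hn]
    refine (Set.ncard_le_ncard (t := ι '' ({v | G.IsInfiniteEmitter v ∧ ¬ G.HasRegularTwin v} \
      {u})) ?_ (Set.toFinite _)).trans_lt ((Set.ncard_image_le (Set.toFinite _)).trans_lt
        (Set.ncard_sdiff_singleton_lt_of_mem ⟨hu, hnt⟩ (Set.toFinite _)))
    intro a ha
    obtain rfl | ⟨a, rfl⟩ := hcases a
    · exact absurd ha.1 htreg.not_isInfiniteEmitter
    · refine ⟨a, ⟨⟨hemit a ha.1, fun h => ha.2 (htwin a h)⟩, ?_⟩, rfl⟩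
      rintro rfl
      exact ha.2 hu') hKfin hKsc hKloop hKinf rfl
  exact ⟨H, hH.1, hH.2.1, hH.2.2.1, hH.2.2.2.1, hH.2.2.2.2.1, hmove.trans hH.2.2.2.2.2⟩

theorem hasPathIn_regular {G : CKGraph} (hsc : G.StronglyConnected)
    (htwin : ∀ u, G.IsInfiniteEmitter u → G.HasRegularTwin u) {u v : G.V}
    (hu : G.Regular u) (hv : G.Regular v) : G.HasPathIn {w | G.Regular w} u v := by
  have hpath := hsc u v
  induction hpath using TransGen.head_induction_on with
  | single h =>
    obtain ⟨e, rfl, rfl⟩ := h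
    exact .single e hu hv
  | @head a c hac _ ih =>
    by_cases hc : G.IsInfiniteEmitter c
    · obtain ⟨t, ht, hin, hout⟩ := htwin c hc
      obtain ⟨e, rfl, rfl⟩ := hin a hac
      obtain ⟨e', he', rfl⟩ := hout v
      refine .cons e hu ?_
      rw [← he'] at ht ⊢
      exact .single e' ht hv
    · have hcv := ih (hsc.regular hc)
      obtain ⟨e, rfl, rfl⟩ := hac
      exact .cons e hu hcv

end OutTwin

end CKGraph

/-- a graph with finitely many vertices, in which every vertex connects
to a loop and whose only hereditary saturated vertex sets are trivial, is
move-equivalent to a graph with finitely many vertices, no sinks, no sources, in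
which every vertex supports a loop of length one, any two regular vertices are
connected by a path of regular vertices, and every infinite emitter emits infinitely
many edges to every vertex. -/
theorem stmt6 (G : CKGraph) (hfin : Finite G.V)
    (hloop : ∀ v : G.V, ∃ w : G.V, G.HasPath w w ∧ G.Geq v w)
    (hsimple : ∀ H : Set G.V, G.Hereditary H → G.Saturated H → H = ∅ ∨ H = Set.univ) :
    ∃ E : CKGraph, Finite E.V ∧ (∀ v : E.V, ¬ E.IsSink v) ∧
      (∀ v : E.V, ¬ E.IsSource v) ∧
      (∀ v : E.V, ∃ e : E.E, E.s e = v ∧ E.r e = v) ∧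
      (∀ u v : E.V, E.Regular u → E.Regular v →
        u = v ∨ E.HasPathIn {w : E.V | E.Regular w} u v) ∧
      (∀ u : E.V, E.IsInfiniteEmitter u →
        ∀ v : E.V, {e : E.E | E.s e = u ∧ E.r e = v}.Infinite) ∧
      CKGraph.MoveEquiv E G := by
  have hsink : ∀ v, ∃ e, G.s e = v := by
    intro v
    obtain ⟨w, hw, hvw⟩ := hloop v
    have hvw' := CKGraph.geq_iff_reflTransGen.1 hvw
    obtain ⟨_, ⟨e, he, _⟩, _⟩ := TransGen.head'_iff.1
      (TransGen.trans_right hvw' (CKGraph.hasPath_iff_transGen.1 hw))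
    exact ⟨e, he⟩
  obtain ⟨G₁, hfin₁, hsc₁, hm₁⟩ := CKGraph.exists_moveEquiv_stronglyConnected hfin hsink
    fun v w hw => CKGraph.reflTransGen_of_simple hsimple hw
  obtain ⟨G₂, hfin₂, hsc₂, hloop₂, hm₂⟩ := CKGraph.exists_moveEquiv_loops hfin₁ hsc₁
  obtain ⟨G₃, hfin₃, hsc₃, hloop₃, hinf₃, hm₃⟩ :=
    CKGraph.exists_moveEquiv_infAdj hfin₂ hsc₂ hloop₂
  obtain ⟨E, hfinE, hscE, hloopE, hinfE, htwinE, hmE⟩ :=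
    CKGraph.exists_moveEquiv_hasRegularTwin hfin₃ hsc₃ (fun v => by
      by_cases hv : G₃.IsInfiniteEmitter v
      · exact (hinf₃ v hv v).adj
      · exact hloop₃ v (hsc₃.regular hv)) hinf₃
  refine ⟨E, hfinE, fun v hv => ?_, fun v hv => ?_, hloopE,
    fun u v hu hv => .inr (CKGraph.hasPathIn_regular hscE htwinE hu hv), hinfE,
    (hm₁.trans (hm₂.trans (hm₃.trans hmE))).symm⟩
  · obtain ⟨e, he, _⟩ := hloopE v
    exact hv e he
  · obtain ⟨e, _, he⟩ := hloopE v
    exact hv e he
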